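/- arXiv:1405.1133 — 2 statements merged into one kernel-verified Lean document; each statement's English description precedes it below -/
import Mathlib

section
/- There exist a constant c > 0 and a threshold n₀ such that for every integer n ≥ n₀, every integer d with 1 ≤ d ≤ (log log n)/(4 log log log n), every real p with 0 < p ≤ 1, and every weighted hypergraph (H,w) of dimension at most d with at most n vertices and positive edge weights, when each vertex is marked independently with probability p, Pr[S(H,w,p) > (log n)^(2^(d+1)) · D(H,w,p)] < n^(−c·(log n)·(log log n)). -/
open Finset

/-- The probability weight of a marking outcome `ω`, when each vertex is marked
independently with probability `p`. -/
noncomputable def markWeight {V : Type} [Fintype V] (p : ℝ) (ω : V → Bool) : ℝ :=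
  ∏ v, if ω v then p else 1 - p

open Classical in
/-- The probability of the event `A` under independent `Bernoulli(p)` marking of
the vertices. -/
noncomputable def markPr {V : Type} [Fintype V] (p : ℝ) (A : (V → Bool) → Prop) : ℝ :=
  ∑ ω : V → Bool, if A ω then markWeight p ω else 0

/-- `S(H,w,p)` evaluated at a marking `ω`: the total weight of fully marked edges. -/
noncomputable def Sval {V : Type} (E : Finset (Finset V)) (w : Finset V → ℝ)
    (ω : V → Bool) : ℝ :=
  ∑ e ∈ E, w e * ∏ v ∈ e, (if ω v then (1 : ℝ) else 0)

/-- `P(H,w,p,x) = Σ_{e ∈ E, x ⊆ e} w(e)·p^(|e|−|x|)`. -/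
noncomputable def Pval {V : Type} [DecidableEq V] (E : Finset (Finset V))
    (w : Finset V → ℝ) (p : ℝ) (x : Finset V) : ℝ :=
  ∑ e ∈ E.filter (fun e => x ⊆ e), w e * p ^ (e.card - x.card)

/-- `D(H,w,p) = max_{x ⊆ V} P(H,w,p,x)`. -/
noncomputable def Dval {V : Type} [Fintype V] [DecidableEq V] (E : Finset (Finset V))
    (w : Finset V → ℝ) (p : ℝ) : ℝ :=
  Finset.univ.sup' Finset.univ_nonempty (fun x : Finset V => Pval E w p x)

lemma markWeight_nonneg {V : Type} [Fintype V] {p : ℝ} (hp : 0 ≤ p) (hp1 : p ≤ 1)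
    (ω : V → Bool) : 0 ≤ markWeight p ω := by
  refine Finset.prod_nonneg fun v _ => ?_
  split_ifs <;> linarith

/-- The probability that all vertices of `A` are marked is `p ^ |A|`. -/
lemma sum_markWeight_mul_indicator {V : Type} [Fintype V] [DecidableEq V] (p : ℝ)
    (A : Finset V) :
    ∑ ω : V → Bool, markWeight p ω * ∏ v ∈ A, (if ω v then (1 : ℝ) else 0) = p ^ A.card := by
  have key : ∀ ω : V → Bool, markWeight p ω * ∏ v ∈ A, (if ω v then (1 : ℝ) else 0)
      = ∏ v, ((if ω v then p else 1 - p) * if v ∈ A then (if ω v then (1 : ℝ) else 0) else 1) := by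
    intro ω
    rw [Finset.prod_mul_distrib, Finset.prod_ite_mem, Finset.univ_inter]
    rfl
  simp_rw [key]
  rw [← Fintype.prod_sum (fun (v : V) (b : Bool) =>
    (if b then p else 1 - p) * if v ∈ A then (if b then (1 : ℝ) else 0) else 1)]
  have h : ∀ v : V, (∑ b : Bool, (if b then p else 1 - p) *
      if v ∈ A then (if b then (1 : ℝ) else 0) else 1) = if v ∈ A then p else 1 := by
    intro v
    by_cases hv : v ∈ A <;> simp [hv]
  simp_rw [h]
  simp

lemma indicator_mul_indicator {V : Type} [DecidableEq V] (ω : V → Bool) (A B : Finset V) :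
    (∏ v ∈ A, (if ω v then (1 : ℝ) else 0)) * ∏ v ∈ B, (if ω v then (1 : ℝ) else 0)
      = ∏ v ∈ A ∪ B, (if ω v then (1 : ℝ) else 0) := by
  simp only [Finset.prod_ite_zero, Finset.prod_const_one, Finset.mem_union, mul_ite, mul_one,
    mul_zero]
  grind

/-- A set of size `m` has at most `(m + 1) ^ d` subsets of size at most `d`. -/
lemma card_powerset_filter_card_le {V : Type} [DecidableEq V] (A : Finset V) (d : ℕ) :
    (A.powerset.filter (fun x => x.card ≤ d)).card ≤ (A.card + 1) ^ d := by
  have hsub : A.powerset.filter (fun x => x.card ≤ d)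
      ⊆ (Finset.range (d + 1)).biUnion (fun i => A.powersetCard i) := by
    intro x hx
    simp only [Finset.mem_filter, Finset.mem_powerset] at hx
    simp only [Finset.mem_biUnion, Finset.mem_range, Finset.mem_powersetCard]
    exact ⟨x.card, by omega, hx.1, rfl⟩
  refine (Finset.card_le_card hsub).trans (Finset.card_biUnion_le.trans ?_)
  rw [add_pow]
  refine Finset.sum_le_sum fun i hi => ?_
  rw [Finset.card_powersetCard, one_pow, mul_one]
  have h1 : 1 ≤ d.choose i := Nat.choose_pos (by simpa [Nat.lt_succ_iff] using hi)
  exact (Nat.choose_le_pow A.card i).trans (Nat.le_mul_of_pos_right _ h1)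

lemma Pval_le_Dval {V : Type} [Fintype V] [DecidableEq V] (E : Finset (Finset V))
    (w : Finset V → ℝ) (p : ℝ) (x : Finset V) : Pval E w p x ≤ Dval E w p :=
  Finset.le_sup' (fun x : Finset V => Pval E w p x) (Finset.mem_univ x)

/-- Conditioned on `A` being marked, the expectation of `S` is at most `(|A| + 1) ^ d * D`. -/
lemma sum_weight_mul_pow_card_sdiff_le {V : Type} [Fintype V] [DecidableEq V]
    {E : Finset (Finset V)} {w : Finset V → ℝ} {p : ℝ} {d : ℕ} (hp : 0 ≤ p)
    (hd : ∀ e ∈ E, e.card ≤ d) (hw : ∀ e ∈ E, 0 < w e) (hD : 0 ≤ Dval E w p) (A : Finset V) :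
    ∑ e ∈ E, w e * p ^ (e \ A).card ≤ ((A.card : ℝ) + 1) ^ d * Dval E w p := by
  have hmap : ∀ e ∈ E, e ∩ A ∈ A.powerset.filter (fun x => x.card ≤ d) := by
    intro e he
    simp only [Finset.mem_filter, Finset.mem_powerset]
    exact ⟨Finset.inter_subset_right,
      (Finset.card_le_card Finset.inter_subset_left).trans (hd e he)⟩
  rw [← Finset.sum_fiberwise_of_maps_to hmap]
  calc _ ≤ ∑ x ∈ A.powerset.filter (fun x => x.card ≤ d), Dval E w p := by
        refine Finset.sum_le_sum fun x _ => le_trans ?_ (Pval_le_Dval E w p x)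
        calc _ = ∑ e ∈ E.filter (fun e => e ∩ A = x), w e * p ^ (e.card - x.card) := by
              refine Finset.sum_congr rfl fun e he => ?_
              rw [Finset.mem_filter] at he
              rw [Finset.card_sdiff, Finset.inter_comm, he.2]
          _ ≤ _ := by
              refine Finset.sum_le_sum_of_subset_of_nonneg ?_ fun e he _ => ?_
              · intro e he
                rw [Finset.mem_filter] at he ⊢
                exact ⟨he.1, he.2 ▸ Finset.inter_subset_left⟩
              · rw [Finset.mem_filter] at he
                exact mul_nonneg (hw e he.1).le (pow_nonneg hp _)
    _ ≤ _ := by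
        rw [Finset.sum_const, nsmul_eq_mul]
        refine mul_le_mul_of_nonneg_right ?_ hD
        exact_mod_cast card_powerset_filter_card_le A d

/-- Moment bound for `S`, restricted to the event that `A` is marked. -/
lemma moment_le {V : Type} [Fintype V] [DecidableEq V]
    {E : Finset (Finset V)} {w : Finset V → ℝ} {p : ℝ} {d : ℕ} (hp : 0 ≤ p)
    (hd : ∀ e ∈ E, e.card ≤ d) (hw : ∀ e ∈ E, 0 < w e) (hD : 0 ≤ Dval E w p)
    (m k : ℕ) (A : Finset V) (hA : A.card + d * k ≤ m) :
    ∑ ω : V → Bool, markWeight p ω *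
        ((∏ v ∈ A, (if ω v then (1 : ℝ) else 0)) * Sval E w ω ^ k)
      ≤ p ^ A.card * (((m : ℝ) + 1) ^ d * Dval E w p) ^ k := by
  induction k generalizing A with
  | zero => simp [sum_markWeight_mul_indicator]
  | succ k ih =>
    set K : ℝ := ((m : ℝ) + 1) ^ d * Dval E w p with hK
    have hK0 : 0 ≤ K := by positivity
    calc _ = ∑ e ∈ E, w e * ∑ ω : V → Bool, markWeight p ω *
          ((∏ v ∈ A ∪ e, (if ω v then (1 : ℝ) else 0)) * Sval E w ω ^ k) := by
          simp_rw [Finset.mul_sum]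
          rw [Finset.sum_comm]
          refine Finset.sum_congr rfl fun ω _ => ?_
          rw [pow_succ]
          nth_rewrite 2 [Sval]
          simp_rw [Finset.mul_sum, ← indicator_mul_indicator]
          refine Finset.sum_congr rfl fun e _ => ?_
          ring
      _ ≤ ∑ e ∈ E, w e * (p ^ (A ∪ e).card * K ^ k) := by
          refine Finset.sum_le_sum fun e he => ?_
          refine mul_le_mul_of_nonneg_left (ih (A ∪ e) ?_) (hw e he).le
          have h1 := Finset.card_union_le A e
          have h2 := hd e he
          rw [mul_add, mul_one] at hA
          omega
      _ = p ^ A.card * K ^ k * ∑ e ∈ E, w e * p ^ (e \ A).card := by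
          rw [Finset.mul_sum]
          refine Finset.sum_congr rfl fun e _ => ?_
          rw [Finset.union_comm, ← Finset.card_sdiff_add_card e A, pow_add]
          ring
      _ ≤ p ^ A.card * K ^ k * K := by
          refine mul_le_mul_of_nonneg_left ?_ (by positivity)
          refine (sum_weight_mul_pow_card_sdiff_le hp hd hw hD A).trans ?_
          refine mul_le_mul_of_nonneg_right ?_ hD
          have : (A.card : ℝ) ≤ m := by
            exact_mod_cast (Nat.le_add_right _ _).trans hA
          gcongr
      _ = _ := by ring

lemma Sval_nonneg {V : Type} {E : Finset (Finset V)} {w : Finset V → ℝ}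
    (hw : ∀ e ∈ E, 0 < w e) (ω : V → Bool) : 0 ≤ Sval E w ω := by
  refine Finset.sum_nonneg fun e he => mul_nonneg (hw e he).le (Finset.prod_nonneg fun v _ => ?_)
  split_ifs <;> norm_num

/-- Markov's inequality for the `k`-th moment. -/
lemma markPr_gt_mul_pow_le {V : Type} [Fintype V] [DecidableEq V] {E : Finset (Finset V)}
    {w : Finset V → ℝ} {p : ℝ} (hp : 0 ≤ p) (hp1 : p ≤ 1) (hw : ∀ e ∈ E, 0 < w e)
    {t : ℝ} (ht : 0 ≤ t) (k : ℕ) :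
    markPr p (fun ω => Sval E w ω > t) * t ^ k
      ≤ ∑ ω : V → Bool, markWeight p ω * Sval E w ω ^ k := by
  classical
  have hPr : markPr p (fun ω => Sval E w ω > t)
      = ∑ ω : V → Bool, if Sval E w ω > t then markWeight p ω else 0 := by
    unfold markPr
    congr!
  rw [hPr, Finset.sum_mul]
  refine Finset.sum_le_sum fun ω _ => ?_
  have h0 := markWeight_nonneg hp hp1 ω
  have hS := Sval_nonneg hw ω
  split_ifs with h
  · gcongr
  · rw [zero_mul]
    positivity

/-- The weight bound `D` is positive as soon as there is an edge. -/
lemma Dval_pos {V : Type} [Fintype V] [DecidableEq V] {E : Finset (Finset V)}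
    {w : Finset V → ℝ} {p : ℝ} (hp : 0 < p) (hw : ∀ e ∈ E, 0 < w e) (hE : E.Nonempty) :
    0 < Dval E w p := by
  refine lt_of_lt_of_le ?_ (Pval_le_Dval E w p ∅)
  rw [Pval, Finset.filter_true_of_mem fun e _ => Finset.empty_subset e]
  exact Finset.sum_pos (fun e he => mul_pos (hw e he) (pow_pos hp _)) hE

/-- If `T ≥ 2 (d k + 1) ^ d`, then `S` exceeds `T * D` with probability at most `2 ^ (-k)`. -/
lemma markPr_gt_mul_Dval_le {V : Type} [Fintype V] [DecidableEq V]
    {E : Finset (Finset V)} {w : Finset V → ℝ} {p : ℝ} {d : ℕ} (hp : 0 < p) (hp1 : p ≤ 1)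
    (hd : ∀ e ∈ E, e.card ≤ d) (hw : ∀ e ∈ E, 0 < w e) (k : ℕ) {T : ℝ}
    (hT : 2 * ((d : ℝ) * k + 1) ^ d ≤ T) :
    markPr p (fun ω => Sval E w ω > T * Dval E w p) ≤ (2 ^ k)⁻¹ := by
  rcases E.eq_empty_or_nonempty with rfl | hE
  · simp [markPr, Sval, Dval, Pval]
  have hD := Dval_pos hp hw hE
  have hT0 : 0 < T := lt_of_lt_of_le (by positivity) hT
  have hmarkov := markPr_gt_mul_pow_le hp.le hp1 hw (mul_pos hT0 hD).le k
  have hmom := moment_le hp.le hd hw hD.le (d * k) k ∅ (by simp)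
  simp only [Finset.prod_empty, one_mul, Finset.card_empty, pow_zero, Nat.cast_mul] at hmom
  have hle : (((d : ℝ) * k + 1) ^ d * Dval E w p) ^ k ≤ (T * Dval E w p / 2) ^ k := by
    have : ((d : ℝ) * k + 1) ^ d * Dval E w p ≤ T * Dval E w p / 2 := by nlinarith
    gcongr
  have hfin := (hmarkov.trans hmom).trans hle
  rw [div_pow, div_eq_mul_inv, mul_comm] at hfin
  exact le_of_mul_le_mul_left hfin (by positivity)

lemma four_mul_le_two_pow_succ {d : ℕ} (hd : 1 ≤ d) : 4 * d ≤ 2 ^ (d + 1) := by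
  induction d, hd using Nat.le_induction with
  | base => norm_num
  | succ d hd ih => rw [pow_succ]; omega

/-- Corollary 1 in Kelsen, for superconstant dimension: there exist `c > 0`
and a threshold `n₀` such that for every integer `n ≥ n₀`, every integer `d` with
`1 ≤ d ≤ (log log n)/(4 log log log n)`, every `0 < p ≤ 1`, and every weighted hypergraph
`(H,w)` of dimension at most `d` with at most `n` vertices and positive weights,
`Pr[S(H,w,p) > (log n)^(2^(d+1))·D(H,w,p)] < n^(−c·(log n)·(log log n))`
(logs base 2). -/
theorem stmt1 :
    ∃ c : ℝ, 0 < c ∧ ∃ n₀ : ℕ, ∀ n : ℕ, n₀ ≤ n →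
      ∀ d : ℕ, 1 ≤ d →
        (d : ℝ) ≤ Real.logb 2 (Real.logb 2 n) / (4 * Real.logb 2 (Real.logb 2 (Real.logb 2 n))) →
        ∀ p : ℝ, 0 < p → p ≤ 1 →
          ∀ (V : Type) (_ : Fintype V) (_ : DecidableEq V)
            (E : Finset (Finset V)) (w : Finset V → ℝ),
            (∀ e ∈ E, e.Nonempty) →
            (∀ e ∈ E, e.card ≤ d) →
            Fintype.card V ≤ n →
            (∀ e ∈ E, 0 < w e) →
            markPr p (fun ω =>
                Sval E w ω > (Real.logb 2 n) ^ (2 ^ (d + 1)) * Dval E w p)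
              < (n : ℝ) ^ (-(c * Real.logb 2 n * Real.logb 2 (Real.logb 2 n))) := by
  refine ⟨1 / 2, by norm_num, 2 ^ 4, fun n hn d hd1 hd p hp hp1 V _ _ E w _ hcard _ hw => ?_⟩
  have hn' : (2 : ℝ) ^ (4 : ℝ) ≤ n := by
    norm_num
    exact_mod_cast hn
  have hn0 : (0 : ℝ) < n := lt_of_lt_of_le (by positivity) hn'
  set L := Real.logb 2 n with hL
  set M := Real.logb 2 L with hM
  have hL4 : 4 ≤ L := (Real.le_logb_iff_rpow_le one_lt_two hn0).2 hn'
  have hM2 : 2 ≤ M := by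
    rw [hM, Real.le_logb_iff_rpow_le one_lt_two (by linarith)]
    norm_num
    exact hL4
  have hlogM : 1 ≤ Real.logb 2 M := by
    rw [Real.le_logb_iff_rpow_le one_lt_two (by linarith)]
    simpa using hM2
  have hML : M ≤ L := by
    rw [hM, Real.logb_le_iff_le_rpow one_lt_two (by linarith)]
    have h := one_add_mul_self_le_rpow_one_add (s := 1) (by norm_num) (p := L) (by linarith)
    norm_num at h
    linarith
  have hdM : (d : ℝ) ≤ M / 4 := by
    refine hd.trans ?_
    gcongr
    linarith
  set k := ⌈L ^ 2 * M⌉₊ with hk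
  have hk1 : L ^ 2 * M ≤ k := Nat.le_ceil _
  have hk2 : (k : ℝ) < L ^ 2 * M + 1 := Nat.ceil_lt_add_one (by positivity)
  have hbase : (d : ℝ) * k + 1 ≤ L ^ 4 / 2 := by
    have h1 : (d : ℝ) * k ≤ M / 4 * (L ^ 2 * M + 1) := by gcongr
    have h2 : M / 4 * (L ^ 2 * M + 1) ≤ L / 4 * (L ^ 2 * L + 1) := by gcongr
    have h3 : (256 : ℝ) ≤ L ^ 4 := by
      calc (256 : ℝ) = 4 ^ 4 := by norm_num
        _ ≤ L ^ 4 := by gcongr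
    have h4 : L * 64 ≤ L * L ^ 3 := by
      gcongr
      calc (64 : ℝ) = 4 ^ 3 := by norm_num
        _ ≤ L ^ 3 := by gcongr
    nlinarith
  have hT : 2 * ((d : ℝ) * k + 1) ^ d ≤ L ^ (2 ^ (d + 1)) := by
    calc 2 * ((d : ℝ) * k + 1) ^ d ≤ 2 ^ d * (L ^ 4 / 2) ^ d := by
          have : (2 : ℝ) ≤ 2 ^ d := le_self_pow₀ one_le_two (by omega)
          gcongr
      _ = L ^ (4 * d) := by rw [← mul_pow, pow_mul]; congr 1; ring
      _ ≤ L ^ (2 ^ (d + 1)) :=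
          pow_le_pow_right₀ (by linarith) (four_mul_le_two_pow_succ hd1)
  refine (markPr_gt_mul_Dval_le hp hp1 hcard hw k hT).trans_lt ?_
  have hn2 : (n : ℝ) = 2 ^ L := (Real.rpow_logb two_pos (by norm_num) hn0).symm
  rw [hn2, ← Real.rpow_mul two_pos.le, ← Real.rpow_natCast, ← Real.rpow_neg two_pos.le]
  refine Real.rpow_lt_rpow_of_exponent_lt one_lt_two ?_
  have : 0 < L ^ 2 * M := by positivity
  linarith [show L * -(1 / 2 * L * M) = -(L ^ 2 * M) / 2 by ring]
end

section
/- Let H = (V,E) be a hypergraph of dimension d ≥ 2, and mark each vertex independently with probability p = 1/(2^{d+1}·Δ(H)). Let X ⊆ V with |X| < d be such that no edge e ∈ E satisfies e ⊆ X. Then the conditional probability, given that every vertex of X is marked, that some vertex of X belongs to a fully marked edge, is strictly less than 1/2; that is, Pr[E_X | C_X] < 1/2. -/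
open Finset

/-- `C_X`: every vertex of `X` is marked. -/
def Cev {V : Type} (X : Finset V) (ω : V → Bool) : Prop := ∀ v ∈ X, ω v = true

/-- `E_X`: some vertex of `X` belongs to a fully marked edge. -/
def Eev {V : Type} (E : Finset (Finset V)) (X : Finset V) (ω : V → Bool) : Prop :=
  ∃ e ∈ E, (∃ v ∈ X, v ∈ e) ∧ ∀ v ∈ e, ω v = true

/-- `N_j(x,H) = {y ⊆ V : x ∪ y ∈ E, x ∩ y = ∅, |y| = j}`. -/
def Nset {V : Type} [Fintype V] [DecidableEq V] (E : Finset (Finset V))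
    (x : Finset V) (j : ℕ) : Finset (Finset V) :=
  Finset.univ.filter (fun y => x ∪ y ∈ E ∧ x ∩ y = ∅ ∧ y.card = j)

/-- The normalized degree `d_j(x,H) = |N_j(x,H)|^(1/j)`. -/
noncomputable def dDeg {V : Type} [Fintype V] [DecidableEq V] (E : Finset (Finset V))
    (x : Finset V) (j : ℕ) : ℝ :=
  ((Nset E x j).card : ℝ) ^ (1 / (j : ℝ))

/-- `Δ_i(H) = max{d_{i−|x|}(x,H) : x ⊆ V, 0 < |x| < i}`. -/
noncomputable def DeltaI {V : Type} [Fintype V] [DecidableEq V] (E : Finset (Finset V))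
    (i : ℕ) : ℝ :=
  sSup {r : ℝ | ∃ x : Finset V, 0 < x.card ∧ x.card < i ∧ r = dDeg E x (i - x.card)}

/-- `Δ(H) = max{Δ_i(H) : 2 ≤ i ≤ d}`. -/
noncomputable def Delta {V : Type} [Fintype V] [DecidableEq V] (E : Finset (Finset V))
    (d : ℕ) : ℝ :=
  sSup {r : ℝ | ∃ i : ℕ, 2 ≤ i ∧ i ≤ d ∧ r = DeltaI E i}

/-- Every vertex of `S` is marked with probability `p ^ |S|`. -/
theorem markPr_Cev {V : Type} [Fintype V] [DecidableEq V] (p : ℝ) (S : Finset V) :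
    markPr p (Cev S) = p ^ S.card := by
  classical
  have hterm : ∀ ω : V → Bool, (if Cev S ω then markWeight p ω else 0) =
      ∏ v, if ω v then p else if v ∈ S then 0 else 1 - p := by
    intro ω
    split_ifs with h
    · refine Finset.prod_congr rfl fun v _ => ?_
      by_cases hv : v ∈ S
      · simp [h v hv]
      · simp [hv]
    · simp only [Cev, not_forall] at h
      obtain ⟨v, hv, hω⟩ := h
      exact (Finset.prod_eq_zero (Finset.mem_univ v) (by simp [hv, hω])).symm
  have hprod := Finset.prod_univ_sum (fun _ : V => (Finset.univ : Finset Bool))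
    (fun v b => if b then p else if v ∈ S then 0 else 1 - p)
  rw [Fintype.piFinset_univ] at hprod
  have hfactor : ∀ v, (∑ b : Bool, if b then p else if v ∈ S then 0 else 1 - p) =
      if v ∈ S then p else 1 := by
    intro v
    by_cases hv : v ∈ S <;> simp [hv]
  have hsum : ∑ ω : V → Bool, (if Cev S ω then markWeight p ω else 0) = p ^ S.card := by
    calc ∑ ω : V → Bool, (if Cev S ω then markWeight p ω else 0)
        = ∑ ω : V → Bool, ∏ v, (if ω v then p else if v ∈ S then 0 else 1 - p) :=
          Finset.sum_congr rfl fun ω _ => hterm ω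
      _ = ∏ v, if v ∈ S then p else 1 := by
          rw [← hprod]
          exact Finset.prod_congr rfl fun v _ => hfactor v
      _ = p ^ S.card := by simp
  rw [markPr, ← hsum]
  congr!

/-- Union bound for markings. -/
theorem markPr_le_sum {V : Type} [Fintype V] {ι : Type} {p : ℝ} (hp0 : 0 ≤ p) (hp1 : p ≤ 1)
    (A : (V → Bool) → Prop) (s : Finset ι) (B : ι → (V → Bool) → Prop)
    (hAB : ∀ ω, A ω → ∃ i ∈ s, B i ω) :
    markPr p A ≤ ∑ i ∈ s, markPr p (B i) := by
  classical
  unfold markPr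
  rw [Finset.sum_comm]
  refine Finset.sum_le_sum fun ω _ => ?_
  have hw : 0 ≤ markWeight p ω :=
    Finset.prod_nonneg fun v _ => by split_ifs <;> linarith
  have hnonneg : ∀ i ∈ s, 0 ≤ if B i ω then markWeight p ω else 0 := fun i _ => by
    split_ifs <;> simp [hw]
  by_cases hA : A ω
  · obtain ⟨i, hi, hB⟩ := hAB ω hA
    have hle := Finset.single_le_sum hnonneg hi
    simp only [hB, if_true] at hle
    simp only [hA, if_true]
    convert hle
  · simp only [hA, if_false]
    convert Finset.sum_nonneg hnonneg

theorem dDeg_le_DeltaI {V : Type} [Fintype V] [DecidableEq V] (E : Finset (Finset V))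
    {x : Finset V} {i : ℕ} (hx0 : 0 < x.card) (hxi : x.card < i) :
    dDeg E x (i - x.card) ≤ DeltaI E i := by
  refine le_csSup (Set.Finite.bddAbove ?_) ⟨x, hx0, hxi, rfl⟩
  refine (Set.finite_range fun x : Finset V => dDeg E x (i - x.card)).subset ?_
  rintro r ⟨y, -, -, rfl⟩
  exact ⟨y, rfl⟩

theorem DeltaI_le_Delta {V : Type} [Fintype V] [DecidableEq V] (E : Finset (Finset V))
    {i d : ℕ} (hi : 2 ≤ i) (hid : i ≤ d) : DeltaI E i ≤ Delta E d := by
  refine le_csSup (Set.Finite.bddAbove ?_) ⟨i, hi, hid, rfl⟩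
  refine ((Set.finite_Icc 2 d).image fun i => DeltaI E i).subset ?_
  rintro r ⟨j, hj, hjd, rfl⟩
  exact ⟨j, ⟨hj, hjd⟩, rfl⟩

theorem card_Nset_le_Delta_pow {V : Type} [Fintype V] [DecidableEq V] (E : Finset (Finset V))
    {x : Finset V} {j d : ℕ} (hx : 0 < x.card) (hj : 0 < j) (hjd : x.card + j ≤ d) :
    ((Nset E x j).card : ℝ) ≤ Delta E d ^ j := by
  have hle : dDeg E x j ≤ Delta E d := by
    have h := dDeg_le_DeltaI E hx (show x.card < x.card + j by omega)
    rw [Nat.add_sub_cancel_left] at h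
    exact h.trans (DeltaI_le_Delta E (by omega) hjd)
  have hnonneg : 0 ≤ dDeg E x j := Real.rpow_nonneg (Nat.cast_nonneg _) _
  calc ((Nset E x j).card : ℝ) = dDeg E x j ^ j := by
        rw [dDeg, one_div, Real.rpow_inv_natCast_pow (Nat.cast_nonneg _) hj.ne']
    _ ≤ Delta E d ^ j := pow_le_pow_left₀ hnonneg hle j

theorem one_le_Delta {V : Type} [Fintype V] [DecidableEq V] {E : Finset (Finset V)}
    {e : Finset V} {d : ℕ} (he : e ∈ E) (he2 : 2 ≤ e.card) (hed : e.card ≤ d) :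
    1 ≤ Delta E d := by
  obtain ⟨v, hv⟩ := Finset.card_pos.mp (show 0 < e.card by omega)
  have hmem : e.erase v ∈ Nset E {v} (e.card - 1) := by
    refine Finset.mem_filter.mpr ⟨Finset.mem_univ _, ?_, ?_, Finset.card_erase_of_mem hv⟩
    · rwa [Finset.singleton_union, Finset.insert_erase hv]
    · simp
  have hdeg : 1 ≤ dDeg E {v} (e.card - 1) :=
    Real.one_le_rpow (by exact_mod_cast Finset.card_pos.mpr ⟨_, hmem⟩) (by positivity)
  have h := dDeg_le_DeltaI E (x := {v}) (i := e.card) (by simp) (by rw [Finset.card_singleton]; omega)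
  rw [Finset.card_singleton] at h
  exact hdeg.trans (h.trans (DeltaI_le_Delta E he2 hed))

/-- At most `Δ(H) ^ j` edges meet `X` exactly in `x` and have `j` vertices outside `X`. -/
theorem card_filter_inter_le_Delta_pow {V : Type} [Fintype V] [DecidableEq V]
    {E : Finset (Finset V)} {d : ℕ} (hE : ∀ e ∈ E, e.card ≤ d) (hΔ : 0 ≤ Delta E d)
    (X : Finset V) {x : Finset V} (hx : x.Nonempty) {j : ℕ} (hj : 0 < j) :
    ((E.filter fun e => e ∩ X = x ∧ (e \ X).card = j).card : ℝ) ≤ Delta E d ^ j := by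
  by_cases hjd : x.card + j ≤ d
  · refine le_trans ?_ (card_Nset_le_Delta_pow E hx.card_pos hj hjd)
    refine Nat.cast_le.mpr (Finset.card_le_card_of_injOn (fun e => e \ X) ?_ ?_)
    · intro e he
      obtain ⟨he, rfl, rfl⟩ := Finset.mem_filter.mp he
      have hunion : e ∩ X ∪ e \ X = e := by grind
      have hinter : e ∩ X ∩ (e \ X) = ∅ := by grind
      exact Finset.mem_filter.mpr ⟨Finset.mem_univ _, by rwa [hunion], hinter, rfl⟩
    · intro e he f hf hef
      obtain ⟨-, he, -⟩ := Finset.mem_filter.mp he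
      obtain ⟨-, hf, -⟩ := Finset.mem_filter.mp hf
      simp only at hef
      rw [← Finset.sdiff_union_inter e X, ← Finset.sdiff_union_inter f X, hef, he, hf]
  · rw [Finset.filter_false_of_mem]
    · simpa using pow_nonneg hΔ j
    · rintro e he ⟨rfl, rfl⟩
      have := hE e he
      have := Finset.card_inter_add_card_sdiff e X
      omega

/-- Weighted count of the edges meeting `X`, by their trace on `X` and the number of vertices
outside `X`. -/
theorem sum_pow_card_sdiff_le {V : Type} [Fintype V] [DecidableEq V]
    {E : Finset (Finset V)} {d : ℕ} (hE : ∀ e ∈ E, e.card ≤ d) (hΔ : 0 ≤ Delta E d)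
    {X : Finset V} (hX : ∀ e ∈ E, ¬ e ⊆ X) {p : ℝ} (hp : 0 ≤ p) :
    ∑ e ∈ E with (e ∩ X).Nonempty, p ^ (e \ X).card ≤
      (2 ^ X.card - 1) * ∑ j ∈ Finset.Icc 1 d, (Delta E d * p) ^ j := by
  have hmaps : ∀ e ∈ E.filter fun e => (e ∩ X).Nonempty,
      (e ∩ X, (e \ X).card) ∈ X.powerset.erase ∅ ×ˢ Finset.Icc 1 d := by
    intro e he
    obtain ⟨he, hne⟩ := Finset.mem_filter.mp he
    have hpos : 0 < (e \ X).card :=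
      Finset.card_pos.mpr (Finset.sdiff_nonempty.mpr (hX e he))
    have hle := (Finset.card_le_card (Finset.sdiff_subset (s := e) (t := X))).trans (hE e he)
    simp only [Finset.mem_product, Finset.mem_erase, Finset.mem_powerset, Finset.mem_Icc]
    exact ⟨⟨hne.ne_empty, Finset.inter_subset_right⟩, hpos, hle⟩
  have hcard : (((X.powerset.erase ∅).card : ℕ) : ℝ) = 2 ^ X.card - 1 := by
    rw [Finset.card_erase_of_mem (Finset.empty_mem_powerset X), Finset.card_powerset,
      Nat.cast_sub Nat.one_le_two_pow]
    norm_num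
  rw [← Finset.sum_fiberwise_of_maps_to hmaps, Finset.sum_product, ← hcard, ← nsmul_eq_mul]
  refine Finset.sum_le_card_nsmul _ _ _ fun x hx => Finset.sum_le_sum fun j hj => ?_
  have hxne : x.Nonempty := Finset.nonempty_iff_ne_empty.mpr (Finset.mem_erase.mp hx).1
  have hcount := card_filter_inter_le_Delta_pow hE hΔ X hxne (Finset.mem_Icc.mp hj).1
  calc ∑ e ∈ (E.filter fun e => (e ∩ X).Nonempty) with (e ∩ X, (e \ X).card) = (x, j),
        p ^ (e \ X).card
      ≤ ∑ e ∈ E with e ∩ X = x ∧ (e \ X).card = j, p ^ (e \ X).card := by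
        refine Finset.sum_le_sum_of_subset_of_nonneg ?_ fun e _ _ => pow_nonneg hp _
        intro e he
        simp only [Finset.mem_filter, Prod.mk.injEq] at he ⊢
        exact ⟨he.1.1, he.2⟩
    _ = (E.filter fun e => e ∩ X = x ∧ (e \ X).card = j).card * p ^ j := by
        rw [← nsmul_eq_mul, ← Finset.sum_const]
        exact Finset.sum_congr rfl fun e he => by rw [(Finset.mem_filter.mp he).2.2]
    _ ≤ (Delta E d * p) ^ j := by
        rw [mul_pow]
        exact mul_le_mul_of_nonneg_right hcount (pow_nonneg hp j)

theorem sum_Icc_pow_le_two_mul {q : ℝ} (hq0 : 0 ≤ q) (hq : q ≤ 1 / 2) (d : ℕ) :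
    ∑ j ∈ Finset.Icc 1 d, q ^ j ≤ 2 * q := by
  have hstrong : ∑ j ∈ Finset.Icc 1 d, q ^ j ≤ 2 * q - 2 * q ^ (d + 1) := by
    induction d with
    | zero => simp
    | succ d ih =>
      rw [Finset.sum_Icc_succ_top (by omega)]
      have h : q ^ (d + 1 + 1) ≤ q ^ (d + 1) * (1 / 2) := by
        rw [pow_succ q (d + 1)]
        exact mul_le_mul_of_nonneg_left hq (pow_nonneg hq0 _)
      linarith
  linarith [pow_nonneg hq0 (d + 1)]

/-- Lemma 1 in Beame–Luby: for a hypergraph `H` of dimension `d ≥ 2`, with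
each vertex marked independently with probability `p = 1/(2^(d+1)·Δ(H))`, and `X ⊆ V`
with `|X| < d` containing no edge, the conditional probability `Pr[E_X | C_X]` that some
vertex of `X` lies in a fully marked edge, given that all of `X` is marked, is `< 1/2`. -/
theorem stmt4 {V : Type} [Fintype V] [DecidableEq V]
    (E : Finset (Finset V)) (d : ℕ)
    (hEne : ∀ e ∈ E, e.Nonempty)
    (hd : 2 ≤ d)
    (hdim : (∀ e ∈ E, e.card ≤ d) ∧ ∃ e ∈ E, e.card = d)
    (X : Finset V) (hXcard : X.card < d)
    (hXnoedge : ∀ e ∈ E, ¬ e ⊆ X) :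
    markPr (1 / (2 ^ (d + 1) * Delta E d)) (fun ω => Eev E X ω ∧ Cev X ω) /
        markPr (1 / (2 ^ (d + 1) * Delta E d)) (fun ω => Cev X ω)
      < 1 / 2 := by
  obtain ⟨hE, e₀, he₀, hcard⟩ := hdim
  have hΔ : 1 ≤ Delta E d := one_le_Delta he₀ (hcard ▸ hd) hcard.le
  have hpow : (8 : ℝ) ≤ 2 ^ (d + 1) :=
    calc (8 : ℝ) = 2 ^ 3 := by norm_num
      _ ≤ 2 ^ (d + 1) := pow_le_pow_right₀ (by norm_num) (by omega)
  set p : ℝ := 1 / (2 ^ (d + 1) * Delta E d) with hp_def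
  have hp0 : 0 < p := by positivity
  have hp1 : p ≤ 1 := by
    rw [hp_def, div_le_one (by positivity)]
    nlinarith
  have hΔp : Delta E d * p = 1 / 2 ^ (d + 1) := by
    rw [hp_def]
    field_simp
  have hunion : markPr p (fun ω => Eev E X ω ∧ Cev X ω) ≤
      p ^ X.card * ∑ e ∈ E with (e ∩ X).Nonempty, p ^ (e \ X).card := by
    rw [Finset.mul_sum]
    refine (markPr_le_sum hp0.le hp1 _ (E.filter fun e => (e ∩ X).Nonempty)
      (fun e => Cev (X ∪ e)) ?_).trans_eq (Finset.sum_congr rfl fun e _ => ?_)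
    · rintro ω ⟨⟨e, he, ⟨v, hvX, hve⟩, hmark⟩, hX⟩
      refine ⟨e, Finset.mem_filter.mpr ⟨he, v, Finset.mem_inter.mpr ⟨hve, hvX⟩⟩, fun w hw => ?_⟩
      exact (Finset.mem_union.mp hw).elim (hX w) (hmark w)
    · rw [markPr_Cev, ← pow_add, ← Finset.card_union_of_disjoint Finset.disjoint_sdiff,
        Finset.union_sdiff_self_eq_union]
  have hgeom := sum_Icc_pow_le_two_mul (q := Delta E d * p) (by positivity)
    (by rw [hΔp]; exact one_div_le_one_div_of_le (by norm_num) (by linarith)) d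
  have hsum : ∑ e ∈ E with (e ∩ X).Nonempty, p ^ (e \ X).card < 1 / 2 := by
    have hXpow : (2 : ℝ) * 2 ^ X.card ≤ 2 ^ d := by
      rw [← pow_succ']
      exact pow_le_pow_right₀ (by norm_num) hXcard
    have hone : (1 : ℝ) ≤ 2 ^ X.card := one_le_pow₀ (by norm_num)
    calc ∑ e ∈ E with (e ∩ X).Nonempty, p ^ (e \ X).card
        ≤ (2 ^ X.card - 1) * ∑ j ∈ Finset.Icc 1 d, (Delta E d * p) ^ j :=
          sum_pow_card_sdiff_le hE (by linarith) hXnoedge hp0.le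
      _ ≤ (2 ^ X.card - 1) * (2 * (1 / 2 ^ (d + 1))) := by
          rw [← hΔp]
          exact mul_le_mul_of_nonneg_left hgeom (by linarith)
      _ = (2 ^ X.card - 1) / 2 ^ d := by
          rw [pow_succ]
          field_simp
      _ < 1 / 2 := by
          rw [div_lt_iff₀ (by positivity)]
          linarith
  have hCev : markPr p (fun ω => Cev X ω) = p ^ X.card := markPr_Cev p X
  have hpX : 0 < p ^ X.card := pow_pos hp0 _
  rw [hCev, div_lt_iff₀ hpX]
  calc _ ≤ _ := hunion
    _ < p ^ X.card * (1 / 2) := mul_lt_mul_of_pos_left hsum hpX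
    _ = 1 / 2 * p ^ X.card := mul_comm _ _
end
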